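/- arXiv:1609.05036 — 2 statements merged into one kernel-verified Lean document; each statement's English description precedes it below -/
import Mathlib

section
/- Let F be a metric separable space, u a probability measure on F, and for each N let (X₁^N,…,X_N^N) be an exchangeable F^N-valued random vector with law u_N. Let μ^N = (1/N)Σ_{i=1}^N δ_{X_i^N} be the empirical measure. Then (u_N)_N is u-chaotic (i.e. for every k and bounded continuous φ₁,…,φ_k, E[φ₁(X₁^N)⋯φ_k(X_k^N)] → Π_i ∫φ_i du) if and only if the law of μ^N converges weakly in P(P(F)) to the Dirac mass δ_u. -/
open MeasureTheory ProbabilityTheory Filter Topology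

/-- The empirical measure `(1/n) Σ_{i} δ_{x i}` of a vector `x : Fin n → F`, as a
probability measure on `F`. -/
noncomputable def empiricalMeasure {F : Type*} [MeasurableSpace F] {n : ℕ}
    [Nonempty (Fin n)] (x : Fin n → F) : ProbabilityMeasure F :=
  ⟨((PMF.uniformOfFintype (Fin n)).map x).toMeasure, inferInstance⟩

/-- The sequence of (exchangeable, symmetric) laws of the vectors
`(X₁^N, …, X_N^N)` is `u`-chaotic: for every `k` and bounded continuous `φ₁, …, φ_k`,
`E[φ₁(X₁^N)⋯φ_k(X_k^N)] → Π_i ∫ φ_i du`.  (Here the `N`-th vector has `N+1`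
coordinates, so every `N` has at least one particle.) -/
def IsChaotic {F : Type*} [MetricSpace F] [MeasurableSpace F] {Ω : Type*} [MeasureSpace Ω]
    (X : (N : ℕ) → Ω → (Fin (N + 1) → F)) (u : ProbabilityMeasure F) : Prop :=
  ∀ k : ℕ, ∀ φ : Fin k → BoundedContinuousFunction F ℝ,
    Tendsto
      (fun N : ℕ =>
        if h : k ≤ N + 1 then
          ∫ ω, ∏ i : Fin k, φ i (X N ω (Fin.castLE h i)) ∂(ℙ : Measure Ω)
        else 0)
      atTop (𝓝 (∏ i : Fin k, ∫ x, φ i x ∂(u : Measure F)))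

lemma integral_empirical {F : Type*} [MetricSpace F] [MeasurableSpace F] [BorelSpace F]
    {n : ℕ} [Nonempty (Fin n)] (x : Fin n → F) (φ : BoundedContinuousFunction F ℝ) :
    ∫ y, φ y ∂(empiricalMeasure x : Measure F) = (n : ℝ)⁻¹ * ∑ i, φ (x i) := by
  have h1 : (empiricalMeasure x : Measure F)
      = Measure.map x (PMF.uniformOfFintype (Fin n)).toMeasure := by
    ext s hs
    rw [Measure.map_apply measurable_from_top hs]
    exact PMF.toMeasure_map_apply _ _ _ measurable_from_top hs
  rw [h1, integral_map measurable_from_top.aemeasurable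
    φ.continuous.measurable.aestronglyMeasurable, PMF.integral_eq_sum]
  simp [Finset.mul_sum]

lemma continuous_empirical {F : Type*} [MetricSpace F] [MeasurableSpace F] [BorelSpace F]
    {n : ℕ} [Nonempty (Fin n)] : Continuous (fun x : Fin n → F => empiricalMeasure x) := by
  rw [ProbabilityMeasure.continuous_iff_forall_continuous_integral]
  intro f
  simp_rw [integral_empirical]
  fun_prop

lemma tendsto_desc (k : ℕ) :
    Tendsto (fun N : ℕ => (((N + 1).descFactorial k : ℕ) : ℝ) / ((N + 1 : ℕ) : ℝ) ^ k)
      atTop (𝓝 1) := by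
  induction k with
  | zero => simp
  | succ k ih =>
    have h2 : Tendsto (fun N : ℕ => 1 - (k : ℝ) * (1 / ((N : ℝ) + 1))) atTop (𝓝 (1 - k * 0)) :=
      tendsto_const_nhds.sub (tendsto_one_div_add_atTop_nhds_zero_nat.const_mul _)
    have h3 := h2.mul ih
    simp only [mul_zero, sub_zero, mul_one] at h3
    refine h3.congr' ?_
    filter_upwards [eventually_ge_atTop k] with N hN
    have : (N : ℝ) + 1 ≠ 0 := by positivity
    rw [Nat.descFactorial_succ, Nat.cast_mul, Nat.cast_sub (by omega)]
    push_cast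
    field_simp
    ring

section
variable {F : Type*} [MetricSpace F] [TopologicalSpace.SeparableSpace F]
    [MeasurableSpace F] [BorelSpace F]
    {Ω : Type*} [MeasureSpace Ω] [IsProbabilityMeasure (ℙ : Measure Ω)]

lemma prod_bound {k : ℕ} (φ : Fin k → BoundedContinuousFunction F ℝ) (y : Fin k → F) :
    |∏ i, φ i (y i)| ≤ ∏ i, ‖φ i‖ := by
  rw [Finset.abs_prod]
  exact Finset.prod_le_prod (fun _ _ => abs_nonneg _) (fun i _ => (φ i).norm_coe_le_norm _)

lemma prod_integrable {n k : ℕ} (Y : Ω → (Fin n → F)) (hY : Measurable Y)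
    (φ : Fin k → BoundedContinuousFunction F ℝ) (f : Fin k → Fin n) :
    Integrable (fun ω => ∏ i, φ i (Y ω (f i))) (ℙ : Measure Ω) := by
  refine Integrable.of_bound (C := ∏ i, ‖φ i‖) (Measurable.aestronglyMeasurable ?_)
    (ae_of_all _ fun ω => prod_bound φ _)
  refine Finset.measurable_prod _ fun i _ => ?_
  exact (φ i).continuous.measurable.comp ((measurable_pi_apply _).comp hY)

lemma key_bound {n k : ℕ} [Nonempty (Fin n)] (h : k ≤ n) (Y : Ω → (Fin n → F)) (hY : Measurable Y)
    (hexch : ∀ σ : Equiv.Perm (Fin n),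
      Measure.map Y (ℙ : Measure Ω) = Measure.map (fun ω => Y ω ∘ σ) (ℙ : Measure Ω))
    (φ : Fin k → BoundedContinuousFunction F ℝ) :
    |(∫ ω, ∏ i, (∫ x, φ i x ∂(empiricalMeasure (Y ω) : Measure F)) ∂(ℙ : Measure Ω)) -
      ∫ ω, ∏ i : Fin k, φ i (Y ω (Fin.castLE h i)) ∂(ℙ : Measure Ω)| ≤
      2 * (∏ i, ‖φ i‖) * (1 - ((n.descFactorial k : ℕ) : ℝ) / (n : ℝ) ^ k) := by
  classical
  have hn : (0 : ℝ) < n := by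
    have : 0 < n := Fin.pos_iff_nonempty.2 inferInstance
    exact_mod_cast this
  set C := ∏ i, ‖φ i‖ with hC
  set G : (Fin k → Fin n) → ℝ := fun f => ∫ ω, ∏ i, φ i (Y ω (f i)) ∂(ℙ : Measure Ω) with hG
  have hGb : ∀ f, |G f| ≤ C := by
    intro f
    have := norm_integral_le_of_norm_le_const (μ := (ℙ : Measure Ω))
      (f := fun ω => ∏ i, φ i (Y ω (f i))) (C := C) (ae_of_all _ fun ω => prod_bound φ _)
    simpa using this
  have hGi : ∀ f, Function.Injective f → G f = G (Fin.castLE h) := by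
    intro f hf
    obtain ⟨σ, hσ⟩ := ((MulAction.isMultiplyPretransitive_iff (G := Equiv.Perm (Fin n))).1
      (Equiv.Perm.isMultiplyPretransitive (Fin n) k)) ⟨Fin.castLE h, Fin.castLE_injective h⟩ ⟨f, hf⟩
    have hσ' : ∀ i, σ (Fin.castLE h i) = f i := fun i => by
      have := DFunLike.congr_fun hσ i
      simpa using this
    have hm : Measurable (fun y : Fin n → F => ∏ i, φ i (y (Fin.castLE h i))) :=
      Finset.measurable_prod _ fun i _ =>
        (φ i).continuous.measurable.comp (measurable_pi_apply _)
    have hY2 : Measurable (fun ω => Y ω ∘ σ) :=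
      measurable_pi_lambda _ fun i => (measurable_pi_apply _).comp hY
    have e1 := integral_map (μ := (ℙ : Measure Ω)) hY.aemeasurable hm.aestronglyMeasurable
    have e2 := integral_map (μ := (ℙ : Measure Ω)) hY2.aemeasurable hm.aestronglyMeasurable
    rw [← hexch σ, e1] at e2
    simp only [Function.comp, hσ'] at e2
    exact e2.symm
  have hS : (∫ ω, ∏ i, (∫ x, φ i x ∂(empiricalMeasure (Y ω) : Measure F)) ∂(ℙ : Measure Ω))
      = ((n : ℝ) ^ k)⁻¹ * ∑ f, G f := by
    simp_rw [integral_empirical, Finset.prod_mul_distrib, Fintype.prod_sum]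
    rw [integral_const_mul, integral_finsetSum _ fun f _ => prod_integrable Y hY φ f]
    simp [hG]
  have hcard : ((Finset.univ.filter (fun f : Fin k → Fin n => Function.Injective f)).card)
      = n.descFactorial k := by
    have := Fintype.card_embedding_eq (α := Fin k) (β := Fin n)
    simp only [Fintype.card_fin] at this
    rw [← this, ← Fintype.card_subtype]
    exact Fintype.card_congr (Equiv.subtypeInjectiveEquivEmbedding _ _)
  have hsum : |∑ f, (G f - G (Fin.castLE h))| ≤ 2 * C * ((n : ℝ) ^ k - (n.descFactorial k : ℕ)) := by
    calc |∑ f, (G f - G (Fin.castLE h))| ≤ ∑ f, |G f - G (Fin.castLE h)| :=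
          Finset.abs_sum_le_sum_abs _ _
      _ ≤ ∑ f : Fin k → Fin n, 2 * C * (1 - if Function.Injective f then (1 : ℝ) else 0) := by
          refine Finset.sum_le_sum fun f _ => ?_
          split_ifs with hf
          · simp [hGi f hf]
          · have a := hGb f
            have b := hGb (Fin.castLE h)
            have := abs_sub (G f) (G (Fin.castLE h))
            linarith
      _ = _ := by
          rw [← Finset.mul_sum, Finset.sum_sub_distrib, ← hcard]
          simp
  have hfin : (((n : ℝ) ^ k)⁻¹ * ∑ f, G f) - G (Fin.castLE h)
      = ((n : ℝ) ^ k)⁻¹ * ∑ f, (G f - G (Fin.castLE h)) := by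
    rw [Finset.sum_sub_distrib]
    simp only [Finset.sum_const, Finset.card_univ, Fintype.card_fun, Fintype.card_fin, nsmul_eq_mul]
    push_cast
    field_simp
  rw [hS]
  change |(((n : ℝ) ^ k)⁻¹ * ∑ f, G f) - G (Fin.castLE h)| ≤ _
  rw [hfin, abs_mul, abs_of_pos (by positivity)]
  calc _ ≤ ((n : ℝ) ^ k)⁻¹ * (2 * C * ((n : ℝ) ^ k - (n.descFactorial k : ℕ))) := by gcongr
    _ = _ := by field_simp

lemma key_iff (X : (N : ℕ) → Ω → (Fin (N + 1) → F))
    (hmeas : ∀ N, Measurable (X N))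
    (hexch : ∀ N : ℕ, ∀ σ : Equiv.Perm (Fin (N + 1)),
      Measure.map (X N) (ℙ : Measure Ω) =
        Measure.map (fun ω => X N ω ∘ σ) (ℙ : Measure Ω))
    {k : ℕ} (φ : Fin k → BoundedContinuousFunction F ℝ) (c : ℝ) :
    Tendsto
      (fun N : ℕ =>
        if h : k ≤ N + 1 then
          ∫ ω, ∏ i : Fin k, φ i (X N ω (Fin.castLE h i)) ∂(ℙ : Measure Ω)
        else 0)
      atTop (𝓝 c) ↔
    Tendsto (fun N : ℕ => ∫ ω, ∏ i, (∫ x, φ i x ∂(empiricalMeasure (X N ω) : Measure F))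
      ∂(ℙ : Measure Ω)) atTop (𝓝 c) := by
  have hd : Tendsto (fun N : ℕ => (∫ ω, ∏ i, (∫ x, φ i x ∂(empiricalMeasure (X N ω) : Measure F))
      ∂(ℙ : Measure Ω)) - (if h : k ≤ N + 1 then
          ∫ ω, ∏ i : Fin k, φ i (X N ω (Fin.castLE h i)) ∂(ℙ : Measure Ω)
        else 0)) atTop (𝓝 0) := by
    have h1 := ((tendsto_const_nhds (x := (1 : ℝ))).sub (tendsto_desc k)).const_mul
      (2 * (∏ i, ‖φ i‖))
    rw [sub_self, mul_zero] at h1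
    refine squeeze_zero_norm' ?_ h1
    filter_upwards [eventually_ge_atTop k] with N hN
    have hN' : k ≤ N + 1 := by omega
    rw [dif_pos hN']
    exact key_bound hN' (X N) (hmeas N) (hexch N) φ
  constructor
  · intro h
    simpa using hd.add h
  · intro h
    simpa using h.sub hd

lemma meas_comp {n : ℕ} [Nonempty (Fin n)] (Y : Ω → (Fin n → F)) (hY : Measurable Y)
    {Φ : ProbabilityMeasure F → ℝ} (hΦ : Continuous Φ) :
    Measurable (fun ω => Φ (empiricalMeasure (Y ω))) :=
  have : SecondCountableTopology F := UniformSpace.secondCountable_of_separable F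
  (hΦ.comp continuous_empirical).measurable.comp hY

lemma abs_integral_le_norm (φ : BoundedContinuousFunction F ℝ) (ν : ProbabilityMeasure F) :
    |∫ x, φ x ∂(ν : Measure F)| ≤ ‖φ‖ := by
  simpa using φ.norm_integral_le_norm (ν : Measure F)

end
theorem stmt8 {F : Type*} [MetricSpace F] [TopologicalSpace.SeparableSpace F]
    [MeasurableSpace F] [BorelSpace F]
    {Ω : Type*} [MeasureSpace Ω] [IsProbabilityMeasure (ℙ : Measure Ω)]
    (X : (N : ℕ) → Ω → (Fin (N + 1) → F))
    (hmeas : ∀ N, Measurable (X N))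
    -- exchangeability of the law of each vector
    (hexch : ∀ N : ℕ, ∀ σ : Equiv.Perm (Fin (N + 1)),
      Measure.map (X N) (ℙ : Measure Ω) =
        Measure.map (fun ω => X N ω ∘ σ) (ℙ : Measure Ω))
    (u : ProbabilityMeasure F) :
    IsChaotic X u ↔
      ∀ Φ : BoundedContinuousFunction (ProbabilityMeasure F) ℝ,
        Tendsto (fun N : ℕ => ∫ ω, Φ (empiricalMeasure (X N ω)) ∂(ℙ : Measure Ω))
          atTop (𝓝 (Φ u)) := by
  constructor
  · intro hch Φ
    -- second moments
    have hsq : ∀ φ : BoundedContinuousFunction F ℝ, Tendsto (fun N : ℕ =>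
        ∫ ω, ((∫ x, φ x ∂(empiricalMeasure (X N ω) : Measure F)) - ∫ x, φ x ∂(u : Measure F)) ^ 2
          ∂(ℙ : Measure Ω)) atTop (𝓝 0) := by
      intro φ
      have h1 := (key_iff X hmeas hexch _ _).1 (hch 1 (fun _ => φ))
      have h2 := (key_iff X hmeas hexch _ _).1 (hch 2 (fun _ => φ))
      simp only [Finset.prod_const, Finset.card_univ, Fintype.card_fin, pow_one] at h1 h2
      set m := ∫ x, φ x ∂(u : Measure F) with hm
      have h3 := (h2.sub (h1.const_mul (2 * m))).add_const (m ^ 2)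
      have e : m ^ 2 - 2 * m * m + m ^ 2 = 0 := by ring
      rw [e] at h3
      refine h3.congr fun N => ?_
      have hc := ProbabilityMeasure.continuous_integral_boundedContinuousFunction φ
      have i1 : Integrable (fun ω => ∫ x, φ x ∂(empiricalMeasure (X N ω) : Measure F))
          (ℙ : Measure Ω) :=
        Integrable.of_bound (C := ‖φ‖) (meas_comp (X N) (hmeas N) hc).aestronglyMeasurable
          (ae_of_all _ fun ω => abs_integral_le_norm φ _)
      have i2 : Integrable (fun ω => (∫ x, φ x ∂(empiricalMeasure (X N ω) : Measure F)) ^ 2)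
          (ℙ : Measure Ω) := by
        refine Integrable.of_bound (C := ‖φ‖ ^ 2)
          ((meas_comp (X N) (hmeas N) hc).pow_const 2).aestronglyMeasurable
          (ae_of_all _ fun ω => ?_)
        rw [norm_pow]
        exact pow_le_pow_left₀ (norm_nonneg _) (abs_integral_le_norm φ _) 2
      have i3 := i1.const_mul (2 * m)
      have e2 : ∀ ω, ((∫ x, φ x ∂(empiricalMeasure (X N ω) : Measure F)) - m) ^ 2
          = (∫ x, φ x ∂(empiricalMeasure (X N ω) : Measure F)) ^ 2
            - 2 * m * (∫ x, φ x ∂(empiricalMeasure (X N ω) : Measure F)) + m ^ 2 := by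
        intro ω; ring
      simp_rw [e2]
      have i4 : Integrable (fun ω => (∫ x, φ x ∂(empiricalMeasure (X N ω) : Measure F)) ^ 2
            - 2 * m * (∫ x, φ x ∂(empiricalMeasure (X N ω) : Measure F))) (ℙ : Measure Ω) :=
        i2.sub i3
      rw [integral_add i4 (integrable_const _), integral_sub i2 i3, integral_const_mul]
      simp
    -- the filter of sets of asymptotically full probability
    let L : Filter (ProbabilityMeasure F) :=
      { sets := {s | Tendsto (fun N : ℕ => (ℙ : Measure Ω).real {ω | empiricalMeasure (X N ω) ∉ s})
          atTop (𝓝 0)}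
        univ_sets := by simp
        sets_of_superset := by
          intro s t hs hst
          refine squeeze_zero (fun _ => measureReal_nonneg) (fun N => ?_) hs
          exact measureReal_mono (fun ω hω h => hω (hst h))
        inter_sets := by
          intro s t hs ht
          have hst := Tendsto.add hs ht
          rw [add_zero] at hst
          refine squeeze_zero (fun _ => measureReal_nonneg) (fun N => ?_) hst
          refine (measureReal_mono ?_).trans (measureReal_union_le _ _)
          intro ω hω
          by_contra hc
          simp only [Set.mem_union, Set.mem_ofPred_eq, not_or, not_not] at hc
          exact hω hc }
    have hL : Tendsto id L (𝓝 u) := by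
      rw [ProbabilityMeasure.tendsto_iff_forall_integral_tendsto]
      intro φ
      rw [Metric.tendsto_nhds]
      intro ε hε
      change Tendsto (fun N : ℕ => (ℙ : Measure Ω).real {ω | empiricalMeasure (X N ω) ∉ _})
          atTop (𝓝 0)
      have h1 := (hsq φ).const_mul (ε ^ 2)⁻¹
      rw [mul_zero] at h1
      refine squeeze_zero (fun _ => measureReal_nonneg) (fun N => ?_) h1
      rw [le_inv_mul_iff₀ (by positivity)]
      have hc : Continuous (fun ν : ProbabilityMeasure F =>
          ((∫ x, φ x ∂(ν : Measure F)) - ∫ x, φ x ∂(u : Measure F)) ^ 2) :=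
        ((ProbabilityMeasure.continuous_integral_boundedContinuousFunction φ).sub
          continuous_const).pow 2
      have hint : Integrable (fun ω => ((∫ x, φ x ∂(empiricalMeasure (X N ω) : Measure F))
          - ∫ x, φ x ∂(u : Measure F)) ^ 2) (ℙ : Measure Ω) := by
        refine Integrable.of_bound (C := (‖φ‖ + ‖φ‖) ^ 2)
          (meas_comp (X N) (hmeas N) hc).aestronglyMeasurable (ae_of_all _ fun ω => ?_)
        rw [norm_pow]
        refine pow_le_pow_left₀ (norm_nonneg _) ((norm_sub_le _ _).trans ?_) 2
        exact add_le_add (abs_integral_le_norm φ _) (abs_integral_le_norm φ _)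
      refine le_trans ?_ (mul_meas_ge_le_integral_of_nonneg
        (ae_of_all _ fun ω => sq_nonneg _) hint (ε ^ 2))
      refine mul_le_mul_of_nonneg_left (measureReal_mono (fun ω hω => ?_) (measure_ne_top _ _))
        (by positivity)
      simp only [id, Set.mem_ofPred_eq, not_lt, Real.dist_eq] at hω ⊢
      rw [← sq_abs (_ - _)]
      exact pow_le_pow_left₀ hε.le hω 2
    have hΦ : Tendsto Φ L (𝓝 (Φ u)) := (Φ.continuous.tendsto u).comp hL
    rw [Metric.tendsto_atTop']
    intro ε hε
    have h1 : Tendsto (fun N : ℕ => (ℙ : Measure Ω).real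
        {ω | empiricalMeasure (X N ω) ∉ {ν | dist (Φ ν) (Φ u) < ε / 2}}) atTop (𝓝 0) :=
      (Metric.tendsto_nhds.1 hΦ) (ε / 2) (by positivity)
    have h2 := (h1.const_mul (2 * ‖Φ‖)).const_add (ε / 2)
    rw [mul_zero, add_zero] at h2
    obtain ⟨N₀, hN₀⟩ := eventually_atTop.1 (h2.eventually (gt_mem_nhds (half_lt_self hε)))
    refine ⟨N₀, fun N hN => lt_of_le_of_lt ?_ (hN₀ N hN.le)⟩
    have hmΦ := meas_comp (X N) (hmeas N) Φ.continuous
    have hi : Integrable (fun ω => Φ (empiricalMeasure (X N ω))) (ℙ : Measure Ω) :=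
      Integrable.of_bound (C := ‖Φ‖) hmΦ.aestronglyMeasurable
        (ae_of_all _ fun ω => Φ.norm_coe_le_norm _)
    set A := {ω | empiricalMeasure (X N ω) ∉ {ν | dist (Φ ν) (Φ u) < ε / 2}} with hA
    have hAm : MeasurableSet A := by
      have : A = {ω | ε / 2 ≤ dist (Φ (empiricalMeasure (X N ω))) (Φ u)} := by
        ext ω; simp [hA]
      rw [this]
      exact measurableSet_le measurable_const (hmΦ.dist measurable_const)
    have e1 : (∫ ω, Φ (empiricalMeasure (X N ω)) ∂(ℙ : Measure Ω)) - Φ u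
        = ∫ ω, (Φ (empiricalMeasure (X N ω)) - Φ u) ∂(ℙ : Measure Ω) := by
      rw [integral_sub hi (integrable_const _)]; simp
    have hAi : Integrable (A.indicator fun _ => 2 * ‖Φ‖) (ℙ : Measure Ω) :=
      (integrable_const _).indicator hAm
    rw [Real.dist_eq, e1]
    calc _ ≤ ∫ ω, (ε / 2 + A.indicator (fun _ => 2 * ‖Φ‖) ω) ∂(ℙ : Measure Ω) := by
          have hg : Integrable (fun ω => ε / 2 + A.indicator (fun _ => 2 * ‖Φ‖) ω)
              (ℙ : Measure Ω) := (integrable_const _).add hAi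
          rw [← Real.norm_eq_abs]
          refine norm_integral_le_of_norm_le hg (ae_of_all _ fun ω => ?_)
          by_cases hω : ω ∈ A
          · rw [Set.indicator_of_mem hω]
            have := Φ.dist_le_two_norm (empiricalMeasure (X N ω)) u
            rw [dist_eq_norm] at this
            linarith
          · rw [Set.indicator_of_notMem hω, add_zero]
            simp only [hA, Set.mem_ofPred_eq, not_not] at hω
            exact hω.le
      _ = _ := by
          rw [integral_add (integrable_const _) hAi, integral_indicator_const _ hAm]
          simp [mul_comm]
  · intro h k φ
    rw [key_iff X hmeas hexch]
    have hc : Continuous (fun ν : ProbabilityMeasure F => ∏ i, ∫ x, φ i x ∂(ν : Measure F)) :=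
      continuous_finsetProd _ fun i _ =>
        ProbabilityMeasure.continuous_integral_boundedContinuousFunction (φ i)
    exact h (BoundedContinuousFunction.ofNormedAddCommGroup _ hc (∏ i, ‖φ i‖) fun ν => by
      rw [Real.norm_eq_abs, Finset.abs_prod]
      exact Finset.prod_le_prod (fun _ _ => abs_nonneg _) fun i _ => abs_integral_le_norm (φ i) ν)
end

section
/- Let F be a Polish space and for each N let (X₁^N,…,X_N^N) be exchangeable F^N-valued random variables with empirical measures μ^N = (1/N)Σ δ_{X_i^N}. Then the family of laws (L(μ^N))_N is tight in P(P(F)) if and only if the family of laws (L(X₁^N))_N is tight in P(F). -/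
open MeasureTheory ProbabilityTheory Filter Topology

open scoped ENNReal NNReal in
lemma empirical_apply {F : Type*} [MeasurableSpace F] {N : ℕ} (x : Fin (N+1) → F)
    {A : Set F} (hA : MeasurableSet A) :
    (empiricalMeasure x : Measure F) A
      = ∑ i, ((N + 1 : ℕ) : ℝ≥0∞)⁻¹ * A.indicator (fun _ => 1) (x i) := by
  change ((PMF.uniformOfFintype (Fin (N+1))).map x).toMeasure A = _
  rw [PMF.toMeasure_map_apply _ _ _ (measurable_of_finite x) hA, PMF.toMeasure_apply_fintype]
  refine Finset.sum_congr rfl fun i _ => ?_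
  by_cases h : x i ∈ A
  · simp [Set.indicator, h]
  · simp [Set.indicator, h]

open scoped ENNReal NNReal in
lemma empirical_measurable {F : Type*} [MeasurableSpace F] {Ω : Type*} [MeasurableSpace Ω] {N : ℕ}
    (Y : Ω → Fin (N+1) → F) (hY : Measurable Y) {A : Set F} (hA : MeasurableSet A) :
    Measurable (fun ω => (empiricalMeasure (Y ω) : Measure F) A) := by
  simp_rw [empirical_apply _ hA]
  refine Finset.measurable_sum _ fun i _ => Measurable.const_mul ?_ _
  exact (measurable_const.indicator hA).comp ((measurable_pi_apply i).comp hY)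

open scoped ENNReal NNReal in
lemma lintegral_empirical {F : Type*} [MeasurableSpace F] {Ω : Type*} [MeasurableSpace Ω] {N : ℕ}
    (P : Measure Ω) (Y : Ω → Fin (N+1) → F) (hY : Measurable Y)
    (hexch : ∀ σ : Equiv.Perm (Fin (N + 1)), Measure.map Y P = Measure.map (fun ω => Y ω ∘ σ) P)
    {A : Set F} (hA : MeasurableSet A) :
    ∫⁻ ω, (empiricalMeasure (Y ω) : Measure F) A ∂P = P {ω | Y ω 0 ∈ A} := by
  have hm : ∀ i, Measurable (fun ω => Y ω i) := fun i => (measurable_pi_apply i).comp hY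
  have key : ∀ i, P {ω | Y ω i ∈ A} = P {ω | Y ω 0 ∈ A} := by
    intro i
    have hS : MeasurableSet {x : Fin (N+1) → F | x 0 ∈ A} := measurable_pi_apply 0 hA
    have h := congrArg (fun m => m {x : Fin (N+1) → F | x 0 ∈ A}) (hexch (Equiv.swap 0 i))
    have hσ : Measurable (fun ω => Y ω ∘ (Equiv.swap 0 i : Equiv.Perm (Fin (N + 1)))) :=
      measurable_pi_lambda _ fun j => hm _
    rw [Measure.map_apply hY hS, Measure.map_apply hσ hS] at h
    simpa using h.symm
  simp_rw [empirical_apply _ hA]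
  have hmi : ∀ i, Measurable fun ω => A.indicator (fun _ => (1:ℝ≥0∞)) (Y ω i) :=
    fun i => (measurable_const.indicator hA).comp (hm i)
  rw [lintegral_finsetSum _ (fun i _ => (hmi i).const_mul _)]
  have h2 : ∀ i, ∫⁻ ω, A.indicator (fun _ => (1:ℝ≥0∞)) (Y ω i) ∂P = P {ω | Y ω 0 ∈ A} := by
    intro i
    rw [← key i]
    exact lintegral_indicator_one (hm i hA)
  simp_rw [lintegral_const_mul _ (hmi _), h2]
  rw [Finset.sum_const, Finset.card_univ, Fintype.card_fin, nsmul_eq_mul, ← mul_assoc,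
    ENNReal.mul_inv_cancel (by simp) (by simp), one_mul]

/-- Sznitman, Proposition 2.2(2): Let `F` be Polish and for each `N` let
`(X₁^N, …, X_N^N)` be exchangeable `F^N`-valued random variables with empirical measures
`μ^N = (1/N) Σ_i δ_{X_i^N}`.  Then the family of laws `(L(μ^N))_N` is tight in `P(P(F))`
if and only if the family of laws `(L(X₁^N))_N` is tight in `P(F)`.  (Here the `N`-th
vector has `N+1` coordinates; tightness of the laws of a family of random variables `V_N`
means: for every `ε > 0` there is a compact `K` with `P(V_N ∉ K) ≤ ε` for all `N`.) -/
theorem stmt9 {F : Type*} [MetricSpace F] [CompleteSpace F]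
    [TopologicalSpace.SeparableSpace F] [MeasurableSpace F] [BorelSpace F]
    {Ω : Type*} [MeasureSpace Ω] [IsProbabilityMeasure (ℙ : Measure Ω)]
    (X : (N : ℕ) → Ω → (Fin (N + 1) → F))
    (hmeas : ∀ N, Measurable (X N))
    -- exchangeability of the law of each vector
    (hexch : ∀ N : ℕ, ∀ σ : Equiv.Perm (Fin (N + 1)),
      Measure.map (X N) (ℙ : Measure Ω) =
        Measure.map (fun ω => X N ω ∘ σ) (ℙ : Measure Ω)) :
    (∀ ε : ℝ, 0 < ε → ∃ K : Set (ProbabilityMeasure F), IsCompact K ∧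
        ∀ N, (ℙ : Measure Ω) {ω | empiricalMeasure (X N ω) ∉ K} ≤ ENNReal.ofReal ε) ↔
      (∀ ε : ℝ, 0 < ε → ∃ K : Set F, IsCompact K ∧
        ∀ N, (ℙ : Measure Ω) {ω | X N ω 0 ∉ K} ≤ ENNReal.ofReal ε) := by
  haveI : SecondCountableTopology F := UniformSpace.secondCountable_of_separable F
  constructor
  · intro h ε hε
    obtain ⟨K, hK, hKP⟩ := h (ε / 2) (half_pos hε)
    have ht := isTightMeasureSet_of_isCompact_closure (S := K) (hK.closure)
    obtain ⟨C, hC, hCK⟩ := isTightMeasureSet_iff_exists_isCompact_measure_compl_le.1 ht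
      (ENNReal.ofReal (ε / 2)) (by simpa using hε)
    refine ⟨C, hC, fun N => ?_⟩
    have hA : MeasurableSet Cᶜ := hC.measurableSet.compl
    have hf := empirical_measurable (X N) (hmeas N) hA
    have hS := measurableSet_lt (measurable_const (a := ENNReal.ofReal (ε / 2))) hf
    calc (ℙ : Measure Ω) {ω | X N ω 0 ∉ C}
        = ∫⁻ ω, (empiricalMeasure (X N ω) : Measure F) Cᶜ :=
          (lintegral_empirical ℙ (X N) (hmeas N) (hexch N) hA).symm
      _ ≤ ∫⁻ ω, (ENNReal.ofReal (ε / 2) + {ω | ENNReal.ofReal (ε / 2) <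
            (empiricalMeasure (X N ω) : Measure F) Cᶜ}.indicator 1 ω) := by
          refine lintegral_mono fun ω => ?_
          by_cases hω : ENNReal.ofReal (ε / 2) < (empiricalMeasure (X N ω) : Measure F) Cᶜ
          · simp only [Set.indicator, Set.mem_ofPred_eq, hω, if_true, Pi.one_apply]
            exact prob_le_one.trans le_add_self
          · exact (not_lt.1 hω).trans le_self_add
      _ = ENNReal.ofReal (ε / 2) + (ℙ : Measure Ω) {ω | ENNReal.ofReal (ε / 2) <
            (empiricalMeasure (X N ω) : Measure F) Cᶜ} := by
          rw [lintegral_add_left measurable_const, lintegral_indicator_one hS]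
          simp
      _ ≤ ENNReal.ofReal (ε / 2) + ENNReal.ofReal (ε / 2) := by
          gcongr
          refine (measure_mono fun ω hω => ?_).trans (hKP N)
          intro hmem
          exact absurd (hCK _ ⟨_, hmem, rfl⟩) (not_le.2 hω)
      _ = ENNReal.ofReal ε := by
          rw [← ENNReal.ofReal_add (by positivity) (by positivity), add_halves]
  · intro h ε hε
    obtain ⟨δ, hδ, hsum⟩ := ENNReal.exists_pos_sum_of_countable
      (ε := ENNReal.ofReal ε) (by simpa using hε) ℕ
    have hs : Summable δ :=
      ENNReal.tsum_coe_ne_top_iff_summable.1 (hsum.trans ENNReal.ofReal_lt_top).ne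
    have hδ0 : Tendsto δ atTop (𝓝 0) := NNReal.tendsto_atTop_zero_of_summable hs
    have hpos : ∀ k, 0 < (δ k : ℝ) := fun k => by exact_mod_cast hδ k
    choose C hC hCP using fun k => h ((δ k : ℝ) * δ k) (mul_pos (hpos k) (hpos k))
    refine ⟨_, isCompact_setOfPred_probabilityMeasure_mass_eq_compl_isCompact_le hδ0 hC
      (Or.inl inferInstance), fun N => ?_⟩
    refine le_trans ?_ hsum.le
    refine le_trans (measure_mono (t := ⋃ k, {ω | (δ k : ENNReal) ≤
      (empiricalMeasure (X N ω) : Measure F) (C k)ᶜ}) ?_) ((measure_iUnion_le _).trans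
        (ENNReal.tsum_le_tsum fun k => ?_))
    · intro ω hω
      simp only [Set.mem_ofPred_eq, not_forall, not_le] at hω
      obtain ⟨k, hk⟩ := hω
      refine Set.mem_iUnion.2 ⟨k, ?_⟩
      rw [Set.mem_ofPred_eq, ← ProbabilityMeasure.ennreal_coeFn_eq_coeFn_toMeasure]
      exact_mod_cast hk.le
    · have hA : MeasurableSet (C k)ᶜ := (hC k).measurableSet.compl
      have hM := mul_meas_ge_le_lintegral (μ := ℙ)
        (empirical_measurable (X N) (hmeas N) hA) (δ k)
      rw [lintegral_empirical ℙ (X N) (hmeas N) (hexch N) hA] at hM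
      have h3 := hM.trans (hCP k N)
      rw [ENNReal.ofReal_mul (hpos k).le, ENNReal.ofReal_coe_nnreal] at h3
      exact (ENNReal.mul_le_mul_iff_right (by exact_mod_cast (hδ k).ne') ENNReal.coe_ne_top).1 h3
end
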